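/- arXiv:0802.1341 — 3 statements merged into one kernel-verified Lean document; each statement's English description precedes it below -/
import Mathlib

section
/- Let (C^n, δ_n, η_n)_{n∈ℕ} be a twisted complex over ℝ whose underlying untwisted complex (C, δ) is acyclic, i.e. H^n(C, δ) = 0 for every n ∈ ℕ (in particular ker δ_0 = 0). Then the completed twisted complex (Ĉ, D) is acyclic: every element c ∈ Ĉ = ∏_{n∈ℕ} C^n with Dc = 0 is of the form c = Db for some b ∈ Ĉ. (This is the key step in the proof of Proposition 2.7 of the paper, which asserts that twisted cohomology is invariant under quasi-isomorphism.) -/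
/-- A recursively chosen `D`-primitive of `c`, for a section `s` of `δ`: its terms are
`s (c (n + 1) - η (b (n - 2)))`, with terms of negative index omitted. -/
def twistedPrimitive {C : ℕ → Type} [∀ n, AddCommGroup (C n)] [∀ n, Module ℝ (C n)]
    (η : ∀ n, C n →ₗ[ℝ] C (n + 3)) (s : ∀ n, C (n + 1) → C n) (c : ∀ n, C n) : ∀ n, C n
  | 0 => s 0 (c 1)
  | 1 => s 1 (c 2)
  | (m + 2) => s (m + 2) (c (m + 3) - η m (twistedPrimitive η s c m))


/-- The twisted differential `D = δ + η` on the completion `Ĉ = ∏ n, C n` of a twisted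
complex: `(D c)ₙ = δ_{n-1}(c_{n-1}) + η_{n-3}(c_{n-3})`, with terms of negative index
omitted. -/
def twistedD (C : ℕ → Type) [∀ n, AddCommGroup (C n)] [∀ n, Module ℝ (C n)]
    (δ : ∀ n, C n →ₗ[ℝ] C (n + 1)) (η : ∀ n, C n →ₗ[ℝ] C (n + 3))
    (c : ∀ n, C n) : ∀ n, C n := fun n =>
  match n with
  | 0 => 0
  | 1 => δ 0 (c 0)
  | 2 => δ 1 (c 1)
  | (m + 3) => δ (m + 2) (c (m + 2)) + η m (c m)

/-- If the underlying untwisted complex `(C, δ)` of a twisted complex `(C, δ, η)` is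
acyclic, then the completed twisted complex `(Ĉ, D = δ + η)` is acyclic: every
`D`-closed element of `Ĉ = ∏ n, C n` is `D`-exact. -/
theorem twisted_acyclic_of_acyclic
    (C : ℕ → Type) [∀ n, AddCommGroup (C n)] [∀ n, Module ℝ (C n)]
    (δ : ∀ n, C n →ₗ[ℝ] C (n + 1)) (η : ∀ n, C n →ₗ[ℝ] C (n + 3))
    (hδδ : ∀ n (x : C n), δ (n + 1) (δ n x) = 0)
    (hδη : ∀ n (x : C n), δ (n + 3) (η n x) = - η (n + 1) (δ n x))
    (hηη : ∀ n (x : C n), η (n + 3) (η n x) = 0)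
    (hacyc0 : ∀ x : C 0, δ 0 x = 0 → x = 0)
    (hacyc : ∀ n (x : C (n + 1)), δ (n + 1) x = 0 → ∃ y : C n, δ n y = x)
    (c : ∀ n, C n) (hc : twistedD C δ η c = 0) :
    ∃ b : ∀ n, C n, twistedD C δ η b = c := by
  have hs : ∀ n (x : C (n + 1)), ∃ y : C n, δ (n + 1) x = 0 → δ n y = x := fun n x => by
    by_cases hx : δ (n + 1) x = 0
    · exact (hacyc n x hx).imp fun _ hy _ => hy
    · exact ⟨0, fun h => absurd h hx⟩
  choose s hs using hs
  have hc1 : δ 1 (c 1) = 0 := congrFun hc 2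
  have hc3 : ∀ m, δ (m + 2) (c (m + 2)) + η m (c m) = 0 := fun m => congrFun hc (m + 3)
  have hc0 : c 0 = 0 := hacyc0 _ (congrFun hc 1)
  have hc2 : δ 2 (c 2) = 0 := by simpa [hc0] using hc3 0
  let b := twistedPrimitive η s c
  have hb0 : δ 0 (b 0) = c 1 := hs 0 _ hc1
  have hb1 : δ 1 (b 1) = c 2 := hs 1 _ hc2
  have hb_step : ∀ m, η (m + 1) (δ m (b m)) = η (m + 1) (c (m + 1)) →
      δ (m + 2) (b (m + 2)) = c (m + 3) - η m (b m) := fun m hm => by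
    refine hs (m + 2) _ ?_
    change δ (m + 3) (c (m + 3) - η m (b m)) = 0
    rw [map_sub, hδη, hm, sub_neg_eq_add]
    exact hc3 (m + 1)
  have hη : ∀ m, η (m + 1) (δ m (b m)) = η (m + 1) (c (m + 1)) := fun m => by
    induction m using Nat.twoStepInduction with
    | zero => rw [hb0]
    | one => rw [hb1]
    | more m ih _ =>
      rw [hb_step m ih, map_sub, hηη, sub_zero]
  refine ⟨b, funext fun n => ?_⟩
  match n with
  | 0 => exact hc0.symm
  | 1 => exact hb0
  | 2 => exact hb1
  | m + 3 =>
    change δ (m + 2) (b (m + 2)) + η m (b m) = c (m + 3)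
    rw [hb_step m (hη m), sub_add_cancel]
end

section
/- Let R be a commutative ring, I ⊆ R an ideal, and M an R-module such that ⋂_{p≥0} I^p·M = 0. Let e, e₀ ∈ R with e − e₀ ∈ I, and suppose that for every p ≥ 0 and every m ∈ I^p·M, if e₀·m ∈ I^{p+1}·M then m ∈ I^{p+1}·M (i.e. multiplication by e₀ is injective on each quotient I^p M / I^{p+1} M). Then multiplication by e is injective on M: for all m ∈ M, e·m = 0 implies m = 0. (This is the algebraic core of Lemma 3.10 of the paper, the Atiyah–Bott argument showing that the equivariant Euler class is not a zero divisor on twisted equivariant cohomology.) -/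
/-- The Atiyah–Bott argument (algebraic core of Lemma 3.10 of the paper): let `R` be a
commutative ring, `I ⊆ R` an ideal and `M` an `R`-module with `⋂_p I^p·M = 0`. If
`e - e₀ ∈ I` and multiplication by `e₀` is injective on each quotient `I^p·M / I^{p+1}·M`,
then multiplication by `e` is injective on `M`. -/
theorem smul_injective_of_graded_injective
    (R : Type*) [CommRing R] (M : Type*) [AddCommGroup M] [Module R M]
    (I : Ideal R)
    (hsep : (⨅ p : ℕ, (I ^ p • ⊤ : Submodule R M)) = ⊥)
    (e e₀ : R) (he : e - e₀ ∈ I)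
    (hgr : ∀ (p : ℕ), ∀ m ∈ (I ^ p • ⊤ : Submodule R M),
      e₀ • m ∈ (I ^ (p + 1) • ⊤ : Submodule R M) →
        m ∈ (I ^ (p + 1) • ⊤ : Submodule R M)) :
    ∀ m : M, e • m = 0 → m = 0 := by
  intro m hm
  have hmem (p : ℕ) : m ∈ (I ^ p • ⊤ : Submodule R M) := by
    induction p with
    | zero => simp
    | succ p ih =>
      refine hgr p m ih ?_
      have h : e₀ • m = -((e - e₀) • m) := by rw [sub_smul, hm, zero_sub, neg_neg]
      rw [h, pow_succ', mul_smul]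
      exact neg_mem (Submodule.smul_mem_smul he ih)
  rw [← Submodule.mem_bot R, ← hsep, Submodule.mem_iInf]
  exact hmem
end

section
/- Fix m ∈ ℕ and an open set U ⊆ ℝ^m. Let J : U → Matrix(m, m, ℝ) be a smooth matrix-valued almost complex structure on U (J(x)² = −1 for all x ∈ U) and let f, g : U → ℝ be smooth functions satisfying the generalized Cauchy–Riemann equations for J. Then the local maximum principle holds for f: for every x ∈ U there exists r > 0 such that the closed ball B̄(x, r) is contained in U and sup_{B̄(x,r)} f = sup_{∂B(x,r)} f and inf_{B̄(x,r)} f = inf_{∂B(x,r)} f, where ∂B(x,r) is the sphere of radius r about x. (Theorem A.1 of the paper, the maximum principle for the real part of a pseudo-holomorphic function on an almost complex manifold, in local coordinates.) -/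
open Metric

open Filter Topology

/-- At a local maximum the second derivative is negative semidefinite. -/
theorem IsLocalMax.second_fderiv_apply_self_nonpos
    {E : Type*} [NormedAddCommGroup E] [NormedSpace ℝ E]
    {F : E → ℝ} {F' : E → E →L[ℝ] ℝ} {F'' : E →L[ℝ] E →L[ℝ] ℝ} {y : E}
    (hmax : IsLocalMax F y) (hF : ∀ᶠ x in 𝓝 y, HasFDerivAt F (F' x) x)
    (hF' : HasFDerivAt F' F'' y) (v : E) : F'' v v ≤ 0 := by
  by_contra! hpos
  set l : ℝ → E := fun t => y + t • v with hl
  have hl0 : l 0 = y := by simp [hl]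
  have hlder (t : ℝ) : HasDerivAt l v t := by
    simpa [hl] using ((hasDerivAt_id t).smul_const v).const_add y
  have hlcont : Tendsto l (𝓝 0) (𝓝 y) := by
    simpa only [hl0] using (hlder 0).continuousAt.tendsto
  have hφ : ∀ᶠ t in 𝓝 (0 : ℝ), HasDerivAt (F ∘ l) (F' (l t) v) t := by
    filter_upwards [hlcont.eventually hF] with t ht
    exact ht.comp_hasDerivAt t (hlder t)
  have hderiv : deriv (F ∘ l) =ᶠ[𝓝 0] fun t => F' (l t) v := hφ.mono fun t ht => ht.deriv
  have hφ' : HasDerivAt (fun t => F' (l t) v) (F'' v v) 0 := by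
    have h : HasFDerivAt F' F'' (l 0) := by rwa [hl0]
    simpa using (h.comp_hasDerivAt (0 : ℝ) (hlder 0)).clm_apply (hasDerivAt_const 0 v)
  have hmaxφ : IsLocalMax (F ∘ l) 0 := by
    simpa only [IsLocalMax, IsMaxFilter, Function.comp_apply, hl0] using hlcont.eventually hmax
  have hminφ : IsLocalMin (F ∘ l) 0 := by
    refine isLocalMin_of_deriv_deriv_pos ?_ hmaxφ.deriv_eq_zero hφ.self_of_nhds.continuousAt
    rwa [hderiv.deriv_eq, hφ'.deriv]
  have hconst : F ∘ l =ᶠ[𝓝 0] fun _ => (F ∘ l) 0 := by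
    filter_upwards [hmaxφ, hminφ] with t h₁ h₂ using le_antisymm h₁ h₂
  have hzero : deriv (deriv (F ∘ l)) 0 = 0 := by
    rw [hconst.deriv.deriv_eq]
    simp
  rw [hderiv.deriv_eq, hφ'.deriv] at hzero
  exact hpos.ne' hzero

/-- The real part of a pseudo-holomorphic function satisfies a second-order equation in the
complex direction spanned by any vector `v`. -/
theorem second_fderiv_add_second_fderiv_of_cauchyRiemann
    {E : Type*} [NormedAddCommGroup E] [NormedSpace ℝ E]
    {f g : E → ℝ} {A : E → E →L[ℝ] E} {y : E}
    (hf : ContDiffAt ℝ 2 f y) (hg : ContDiffAt ℝ 2 g y) (hA : DifferentiableAt ℝ A y)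
    (hsq : ∀ v, A y (A y v) = -v)
    (hCR : ∀ᶠ x in 𝓝 y, fderiv ℝ g x = -(fderiv ℝ f x).comp (A x)) (v : E) :
    fderiv ℝ (fderiv ℝ f) y v v + fderiv ℝ (fderiv ℝ f) y (A y v) (A y v) =
      fderiv ℝ f y (fderiv ℝ A y v (A y v) - fderiv ℝ A y (A y v) v) := by
  have hf' : DifferentiableAt ℝ (fderiv ℝ f) y :=
    (hf.fderiv_right (m := 1) (by norm_num)).differentiableAt (by norm_num)
  have hD := hf'.hasFDerivAt.clm_comp hA.hasFDerivAt
  have hgD : HasFDerivAt (fderiv ℝ g) _ y := hD.neg.congr_of_eventuallyEq hCR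
  have hsymm (u w : E) : fderiv ℝ (fderiv ℝ g) y u w = fderiv ℝ (fderiv ℝ g) y w u :=
    (hg.isSymmSndFDerivAt (by simp)) u w
  have hfsymm : fderiv ℝ (fderiv ℝ f) y (A y v) v = fderiv ℝ (fderiv ℝ f) y v (A y v) :=
    (hf.isSymmSndFDerivAt (by simp)) _ _
  have h := hsymm v (A y v)
  rw [hgD.fderiv] at h
  simp [hsq] at h
  rw [map_sub]
  linarith

/-- A weak maximum principle on small balls for an operator which is elliptic only in the
directions `v` and `w y`. -/
theorem exists_mem_sphere_forall_le_of_second_fderiv_add_eq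
    {E : Type*} [NormedAddCommGroup E] [InnerProductSpace ℝ E] [FiniteDimensional ℝ E]
    [Nontrivial E] {f : E → ℝ} {w c : E → E} {v x₀ : E} {r : ℝ} (hr : 0 < r)
    (hf : ∀ y ∈ closedBall x₀ r, ContDiffAt ℝ 2 f y)
    (heq : ∀ y ∈ closedBall x₀ r,
      fderiv ℝ (fderiv ℝ f) y v v + fderiv ℝ (fderiv ℝ f) y (w y) (w y) = fderiv ℝ f y (c y))
    (hc : ∀ y ∈ closedBall x₀ r, inner ℝ (y - x₀) (c y) < inner ℝ v v) :
    ∃ z ∈ sphere x₀ r, ∀ y ∈ closedBall x₀ r, f y ≤ f z := by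
  have hfc : ContinuousOn f (closedBall x₀ r) := fun y hy =>
    (hf y hy).continuousAt.continuousWithinAt
  obtain ⟨z, hz, hzmax⟩ := (isCompact_sphere x₀ r).exists_isMaxOn
    (NormedSpace.sphere_nonempty.2 hr.le) (hfc.mono sphere_subset_closedBall)
  refine ⟨z, hz, fun y hy => ?_⟩
  by_contra! hlt
  obtain ⟨ε, hε, hεr⟩ : ∃ ε > 0, ε * r ^ 2 < f y - f z :=
    ⟨(f y - f z) / (2 * r ^ 2), by have := sub_pos.2 hlt; positivity, by
      field_simp; linarith⟩
  set F : E → ℝ := fun x => f x + ε * ‖x - x₀‖ ^ 2 with hF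
  obtain ⟨p, hp, hpmax⟩ := (isCompact_closedBall x₀ r).exists_isMaxOn
    (nonempty_closedBall.2 hr.le) (show ContinuousOn F (closedBall x₀ r) by fun_prop)
  have hpball : p ∈ ball x₀ r := by
    rw [mem_ball]
    refine lt_of_le_of_ne hp fun heq => ?_
    have h₁ : F y ≤ F p := hpmax hy
    have h₂ : f p ≤ f z := hzmax (mem_sphere.2 heq)
    have h₃ : 0 ≤ ε * ‖y - x₀‖ ^ 2 := by positivity
    simp only [hF, ← dist_eq_norm, heq] at h₁
    rw [← dist_eq_norm] at h₃
    linarith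
  have hnhds : closedBall x₀ r ∈ 𝓝 p :=
    mem_of_superset (isOpen_ball.mem_nhds hpball) ball_subset_closedBall
  have hlocmax : IsLocalMax F p := hpmax.isLocalMax hnhds
  have hFder : ∀ᶠ x in 𝓝 p,
      HasFDerivAt F (fderiv ℝ f x + ε • (2 : ℝ) • innerSL ℝ (x - x₀)) x := by
    filter_upwards [hnhds] with x hx
    have h := ((hasFDerivAt_id x).sub_const x₀).norm_sq.const_mul ε
    refine (((hf x hx).differentiableAt (by norm_num)).hasFDerivAt.add h).congr_fderiv ?_
    ext u
    simp
  let B : E →L[ℝ] E →L[ℝ] ℝ := innerSL ℝ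
  have hB (u : E) : B u u = inner ℝ u u := rfl
  have hF'der : HasFDerivAt (fun x => fderiv ℝ f x + ε • (2 : ℝ) • innerSL ℝ (x - x₀))
      (fderiv ℝ (fderiv ℝ f) p + ε • (2 : ℝ) • B) p := by
    have hf' : DifferentiableAt ℝ (fderiv ℝ f) p :=
      ((hf p hp).fderiv_right (m := 1) (by norm_num)).differentiableAt (by norm_num)
    have h : HasFDerivAt (fun x : E => innerSL ℝ (x - x₀)) B p := by
      exact B.hasFDerivAt.comp p ((hasFDerivAt_id p).sub_const x₀)
    exact hf'.hasFDerivAt.add ((h.const_smul (2 : ℝ)).const_smul ε)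
  have hv := hlocmax.second_fderiv_apply_self_nonpos hFder hF'der v
  have hw := hlocmax.second_fderiv_apply_self_nonpos hFder hF'der (w p)
  have hgrad := DFunLike.congr_fun (hlocmax.hasFDerivAt_eq_zero hFder.self_of_nhds) (c p)
  simp only [add_apply, smul_apply, innerSL_apply_apply, smul_eq_mul, zero_apply, hB] at hv hw hgrad
  have hww : 0 ≤ ε * (2 * inner ℝ (w p) (w p)) := by
    have := real_inner_self_nonneg (x := w p)
    positivity
  have hlt' := mul_lt_mul_of_pos_left (hc p hp) hε
  linarith [heq p hp]

/-- Around every point there is a closed ball on which the real part of a pseudo-holomorphic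
function attains its maximum and its minimum on the boundary sphere. -/
theorem exists_closedBall_extrema_mem_sphere_of_cauchyRiemann
    {E : Type*} [NormedAddCommGroup E] [InnerProductSpace ℝ E] [FiniteDimensional ℝ E]
    [Nontrivial E] {U : Set E} (hU : IsOpen U) {f g : E → ℝ} {A : E → E →L[ℝ] E}
    (hf : ContDiffOn ℝ 2 f U) (hg : ContDiffOn ℝ 2 g U) (hA : ContDiffOn ℝ 1 A U)
    (hsq : ∀ x ∈ U, ∀ v, A x (A x v) = -v)
    (hCR : ∀ x ∈ U, fderiv ℝ g x = -(fderiv ℝ f x).comp (A x)) {x : E} (hx : x ∈ U) :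
    ∃ r > 0, closedBall x r ⊆ U ∧
      (∃ z ∈ sphere x r, ∀ y ∈ closedBall x r, f y ≤ f z) ∧
      ∃ z ∈ sphere x r, ∀ y ∈ closedBall x r, f z ≤ f y := by
  obtain ⟨v, hv⟩ := exists_ne (0 : E)
  set c : E → E := fun y => fderiv ℝ A y v (A y v) - fderiv ℝ A y (A y v) v with hcdef
  have hcont : ContinuousAt c x := by
    have hA' : ContinuousAt A x := hA.continuousOn.continuousAt (hU.mem_nhds hx)
    have hdA : ContinuousAt (fderiv ℝ A) x :=
      (hA.continuousOn_fderiv_of_isOpen hU le_rfl).continuousAt (hU.mem_nhds hx)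
    fun_prop
  have hev : ∀ᶠ y in 𝓝 x, inner ℝ (y - x) (c y) < inner ℝ v v := by
    have h : ContinuousAt (fun y => inner ℝ (y - x) (c y)) x :=
      (continuousAt_id.sub continuousAt_const).inner hcont
    refine h.eventually_lt continuousAt_const ?_
    simpa using real_inner_self_pos.2 hv
  obtain ⟨r, hr, hball⟩ := Metric.nhds_basis_closedBall.mem_iff.1
    (inter_mem (hU.mem_nhds hx) hev)
  have hfat (y) (hy : y ∈ closedBall x r) : ContDiffAt ℝ 2 f y :=
    hf.contDiffAt (hU.mem_nhds (hball hy).1)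
  have heq (y) (hy : y ∈ closedBall x r) := by
    have hyU := hU.mem_nhds (hball hy).1
    exact second_fderiv_add_second_fderiv_of_cauchyRiemann (hfat y hy) (hg.contDiffAt hyU)
      ((hA.contDiffAt hyU).differentiableAt one_ne_zero) (hsq y (hball hy).1)
      (mem_of_superset hyU hCR) v
  refine ⟨r, hr, fun y hy => (hball hy).1, ?_, ?_⟩
  · exact exists_mem_sphere_forall_le_of_second_fderiv_add_eq hr hfat heq
      fun y hy => (hball hy).2
  · have hneg : fderiv ℝ (-f) = -fderiv ℝ f := by
      ext1 y
      exact fderiv_neg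
    obtain ⟨z, hz, hmax⟩ := exists_mem_sphere_forall_le_of_second_fderiv_add_eq
      (f := -f) (w := fun y => A y v) (c := c) (v := v) hr (fun y hy => (hfat y hy).neg)
      (fun y hy => by
        rw [hneg, fderiv_neg]
        simp only [neg_apply, Pi.neg_apply]
        linarith [heq y hy])
      fun y hy => (hball hy).2
    exact ⟨z, hz, fun y hy => neg_le_neg_iff.1 (hmax y hy)⟩

/-- Theorem A.1 of the paper, in local coordinates: the local maximum principle for the
real part of a pseudo-holomorphic function. Let `U ⊆ ℝ^m` (`m ≥ 1`) be open, let
`J : U → Matrix(m,m,ℝ)` be a smooth matrix-valued almost complex structure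
(`J(x)² = −1` on `U`), and let `f, g` be smooth functions on `U` satisfying the
generalized Cauchy–Riemann equations for `J`. Then around every point of `U` there is a
closed ball contained in `U` on which `sup f` and `inf f` are attained on the boundary
sphere. -/
theorem local_maximum_principle_pseudoholomorphic
    (m : ℕ) (hm : 0 < m)
    (U : Set (EuclideanSpace ℝ (Fin m))) (hU : IsOpen U)
    (J : EuclideanSpace ℝ (Fin m) → Fin m → Fin m → ℝ)
    (hJsmooth : ∀ p q : Fin m, ContDiffOn ℝ (⊤ : ℕ∞) (fun x => J x p q) U)
    (hJsq : ∀ x ∈ U, ∀ i j : Fin m,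
      ∑ k : Fin m, J x i k * J x k j = if i = j then (-1 : ℝ) else 0)
    (f g : EuclideanSpace ℝ (Fin m) → ℝ)
    (hf : ContDiffOn ℝ (⊤ : ℕ∞) f U) (hg : ContDiffOn ℝ (⊤ : ℕ∞) g U)
    -- the generalized Cauchy–Riemann equations:
    -- `∂f/∂x_k = Σ_p J_{p,k} ∂g/∂x_p` and `∂g/∂x_k = −Σ_p J_{p,k} ∂f/∂x_p`
    (hCR₁ : ∀ x ∈ U, ∀ k : Fin m,
      fderiv ℝ f x (EuclideanSpace.single k 1)
        = ∑ p : Fin m, J x p k * fderiv ℝ g x (EuclideanSpace.single p 1))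
    (hCR₂ : ∀ x ∈ U, ∀ k : Fin m,
      fderiv ℝ g x (EuclideanSpace.single k 1)
        = - ∑ p : Fin m, J x p k * fderiv ℝ f x (EuclideanSpace.single p 1)) :
    ∀ x ∈ U, ∃ r > (0 : ℝ), closedBall x r ⊆ U ∧
      sSup (f '' closedBall x r) = sSup (f '' sphere x r) ∧
      sInf (f '' closedBall x r) = sInf (f '' sphere x r) := by
  intro x hx
  have : Nonempty (Fin m) := ⟨⟨0, hm⟩⟩
  set A : EuclideanSpace ℝ (Fin m) → EuclideanSpace ℝ (Fin m) →L[ℝ] EuclideanSpace ℝ (Fin m) :=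
    fun x => Matrix.toEuclideanCLM (n := Fin m) (𝕜 := ℝ) (Matrix.of (J x)) with hA
  have hAsmooth : ContDiffOn ℝ 1 A U := by
    have hJ : ContDiffOn ℝ 1 J U := contDiffOn_pi.2 fun p => contDiffOn_pi.2 fun q =>
      (hJsmooth p q).of_le (by norm_cast)
    let T : (Fin m → Fin m → ℝ) →ₗ[ℝ]
        EuclideanSpace ℝ (Fin m) →L[ℝ] EuclideanSpace ℝ (Fin m) :=
      (Matrix.toEuclideanCLM (n := Fin m) (𝕜 := ℝ)).toAlgEquiv.toLinearMap ∘ₗ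
        (Matrix.ofLinearEquiv ℝ).toLinearMap
    exact (LinearMap.toContinuousLinearMap T).contDiff.comp_contDiffOn hJ
  have hAsq : ∀ y ∈ U, ∀ v, A y (A y v) = -v := by
    intro y hy v
    have hmat : Matrix.of (J y) * Matrix.of (J y) = -1 := by
      ext i j
      simp only [Matrix.mul_apply, Matrix.of_apply, hJsq y hy, Matrix.neg_apply, Matrix.one_apply]
      split_ifs <;> simp
    rw [← mul_apply_eq_comp, hA, ← map_mul, hmat]
    simp
  have hAsingle (y) (k : Fin m) : A y (EuclideanSpace.single k 1) =
      ∑ p, J y p k • EuclideanSpace.single p 1 := by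
    ext i
    simp [hA, Matrix.ofLp_toEuclideanCLM, Finset.sum_apply, Pi.single_apply]
  have hCR : ∀ y ∈ U, fderiv ℝ g y = -(fderiv ℝ f y).comp (A y) := by
    intro y hy
    refine ContinuousLinearMap.coe_injective
      ((EuclideanSpace.basisFun (Fin m) ℝ).toBasis.ext fun k => ?_)
    simp [hCR₂ y hy, hAsingle]
  obtain ⟨r, hr, hball, ⟨z, hz, hmax⟩, ⟨z', hz', hmin⟩⟩ :=
    exists_closedBall_extrema_mem_sphere_of_cauchyRiemann hU
      (hf.of_le (by norm_cast)) (hg.of_le (by norm_cast))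
      hAsmooth hAsq hCR hx
  have hsub : sphere x r ⊆ closedBall x r := sphere_subset_closedBall
  refine ⟨r, hr, hball, ?_, ?_⟩
  · have h₁ : IsGreatest (f '' closedBall x r) (f z) :=
      ⟨⟨z, hsub hz, rfl⟩, Set.forall_mem_image.2 hmax⟩
    have h₂ : IsGreatest (f '' sphere x r) (f z) :=
      ⟨⟨z, hz, rfl⟩, Set.forall_mem_image.2 fun y hy => hmax y (hsub hy)⟩
    rw [h₁.csSup_eq, h₂.csSup_eq]
  · have h₁ : IsLeast (f '' closedBall x r) (f z') :=
      ⟨⟨z', hsub hz', rfl⟩, Set.forall_mem_image.2 hmin⟩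
    have h₂ : IsLeast (f '' sphere x r) (f z') :=
      ⟨⟨z', hz', rfl⟩, Set.forall_mem_image.2 fun y hy => hmin y (hsub hy)⟩
    rw [h₁.csInf_eq, h₂.csInf_eq]
end
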